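/- Let R be a unital ring with involution, a ∈ R core invertible with core inverse a^co, and e ∈ R such that 1 + a^co e is invertible. With α = (1 + a^co e)⁻¹, β = (1 + e a^co)⁻¹, ε = (1 − a a^co) e α (1 − a^co a), f = a + e − ε, γ = α(1 − a^co a) β⁻¹ a a^co β, σ = α a^co a α⁻¹ (1 − a a^co) β, δ = β* (a^co)* e* (1 − a a^co) β, and f₀ = α a^co, the following identities hold: f₀ f² = (1 − γ) f, f² f₀ = f (1 − σ), and f* f f₀ = f* (1 − δ). -/

import Mathlib

/-- `x` is the core inverse of `a`. -/
def IsCoreInverse {R : Type*} [Ring R] [StarRing R] (a x : R) : Prop :=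
  a * x * a = a ∧ x * a * x = x ∧ star (a * x) = a * x ∧ a * (x * x) = x ∧ x * (a * a) = a

/-- If `α` inverts `1 + x * e`, then `1 - e * α * x` inverts `1 + e * x`. -/
theorem ringInverse_one_add_mul_swap {R : Type*} [Ring R] {x e α : R}
    (hl : α * (1 + x * e) = 1) (hr : (1 + x * e) * α = 1) :
    Ring.inverse (1 + e * x) = 1 - e * α * x := by
  have h₁ : (1 + e * x) * (1 - e * α * x) = 1 := by
    calc (1 + e * x) * (1 - e * α * x) = 1 + e * x - e * ((1 + x * e) * α) * x := by noncomm_ring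
      _ = 1 := by rw [hr]; noncomm_ring
  have h₂ : (1 - e * α * x) * (1 + e * x) = 1 := by
    calc (1 - e * α * x) * (1 + e * x) = 1 + e * x - e * (α * (1 + x * e)) * x := by noncomm_ring
      _ = 1 := by rw [hl]; noncomm_ring
  exact Ring.inverse_unit (⟨1 + e * x, 1 - e * α * x, h₁, h₂⟩ : Rˣ)

/-- `f₀ f² = (1 - γ) f`, `f² f₀ = f (1 - σ)`, `f* f f₀ = f* (1 - δ)`. -/
theorem f_squared_identities {R : Type*} [Ring R] [StarRing R] (a aco e : R)
    (ha : IsCoreInverse a aco)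
    (hu : IsUnit (1 + aco * e))
    (α β ε f γ σ δ f₀ : R)
    (hα : α = Ring.inverse (1 + aco * e))
    (hβ : β = Ring.inverse (1 + e * aco))
    (hε : ε = (1 - a * aco) * e * α * (1 - aco * a))
    (hf : f = a + e - ε)
    (hγ : γ = α * (1 - aco * a) * (1 + e * aco) * (a * aco) * β)
    (hσ : σ = α * (aco * a) * (1 + aco * e) * (1 - a * aco) * β)
    (hδ : δ = star β * star aco * star e * (1 - a * aco) * β)
    (hf₀ : f₀ = α * aco) :
    f₀ * (f * f) = (1 - γ) * f ∧
    f * f * f₀ = f * (1 - σ) ∧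
    star f * f * f₀ = star f * (1 - δ) := by
  obtain ⟨haxa, hxax, hsa, -, -⟩ := ha
  have hl : α * (1 + aco * e) = 1 := hα ▸ Ring.inverse_mul_cancel _ hu
  have hr : (1 + aco * e) * α = 1 := hα ▸ Ring.mul_inverse_cancel _ hu
  have hβ' : β = 1 - e * α * aco := hβ.trans (ringInverse_one_add_mul_swap hl hr)
  have hα₁ : α = 1 - aco * e * α := by
    rw [eq_sub_iff_add_eq, ← hr]; noncomm_ring
  have hα₂ : α * aco * e = 1 - α := by
    rw [eq_sub_iff_add_eq, ← hl]; noncomm_ring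
  have hxp : aco * (1 - a * aco) = 0 := by
    rw [mul_sub, mul_one, ← mul_assoc, hxax, sub_self]
  have hpa : (1 - a * aco) * a = 0 := by rw [sub_mul, one_mul, haxa, sub_self]
  have haq : a * (1 - aco * a) = 0 := by
    rw [mul_sub, mul_one, ← mul_assoc, haxa, sub_self]
  have hqx : (1 - aco * a) * aco = 0 := by rw [sub_mul, one_mul, hxax, sub_self]
  have hβe : β * e = e * α := by
    calc β * e = e - e * (α * aco * e) := by rw [hβ']; noncomm_ring
      _ = e * α := by rw [hα₂]; noncomm_ring
  have hxβ : aco * β = α * aco := by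
    calc aco * β = (1 - aco * e * α) * aco := by rw [hβ']; noncomm_ring
      _ = α * aco := by rw [← hα₁]
  have hexβ : e * aco * β = 1 - β := by
    rw [mul_assoc, hxβ, hβ']; noncomm_ring
  have hvβ : (1 + e * aco) * β = 1 := by rw [add_mul, hexβ]; noncomm_ring
  have hβp : β * (1 - a * aco) = 1 - a * aco := by
    calc β * (1 - a * aco) = (1 - a * aco) - e * α * (aco * (1 - a * aco)) := by
          rw [hβ']; noncomm_ring
      _ = 1 - a * aco := by rw [hxp]; noncomm_ring
  have hqα : (1 - aco * a) * α = 1 - aco * a := by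
    calc (1 - aco * a) * α = (1 - aco * a) * (1 - aco * e * α) := by rw [← hα₁]
      _ = (1 - aco * a) - ((1 - aco * a) * aco) * (e * α) := by noncomm_ring
      _ = 1 - aco * a := by rw [hqx]; noncomm_ring
  have hpp : (1 - a * aco) * (1 - a * aco) = 1 - a * aco := by
    rw [sub_mul, one_mul, mul_assoc, hxp, mul_zero, sub_zero]
  have hqq : (1 - aco * a) * (1 - aco * a) = 1 - aco * a := by
    rw [sub_mul, one_mul, mul_assoc, haq, mul_zero, sub_zero]
  -- The left and right annihilators of `f` that drive all three identities.
  have hleft : (1 - a * aco) * β * f = 0 := by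
    calc (1 - a * aco) * β * f
        = (1 - a * aco) * β * a + (1 - a * aco) * (β * e)
          - (1 - a * aco) * (β * (1 - a * aco)) * e * α * (1 - aco * a) := by
          rw [hf, hε]; noncomm_ring
      _ = (1 - a * aco) * (1 - e * α * aco) * a + (1 - a * aco) * (e * α)
          - (1 - a * aco) * e * α * (1 - aco * a) := by rw [hβp, hpp, hβe, ← hβ']
      _ = (1 - a * aco) * a := by noncomm_ring
      _ = 0 := hpa
  have hright : f * (α * (1 - aco * a)) = 0 := by
    calc f * (α * (1 - aco * a))
        = a * α * (1 - aco * a) + e * α * (1 - aco * a)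
          - (1 - a * aco) * e * α * (((1 - aco * a) * α) * (1 - aco * a)) := by
          rw [hf, hε]; noncomm_ring
      _ = a * (1 - aco * e * α) * (1 - aco * a) + e * α * (1 - aco * a)
          - (1 - a * aco) * e * α * (1 - aco * a) := by rw [hqα, hqq, ← hα₁]
      _ = a * (1 - aco * a) := by noncomm_ring
      _ = 0 := haq
  have hff₀ : f * f₀ = 1 - (1 - a * aco) * β := by
    calc f * f₀ = a * (α * aco) + e * (α * aco)
          - (1 - a * aco) * e * α * (((1 - aco * a) * α) * aco) := by
          rw [hf, hε, hf₀]; noncomm_ring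
      _ = a * (aco * β) + e * aco * β := by
          rw [hqα, hqx, ← hxβ]; noncomm_ring
      _ = 1 - (1 - a * aco) * β := by rw [hexβ]; noncomm_ring
  have hf₀f : f₀ * f = 1 - α * (1 - aco * a) := by
    calc f₀ * f = α * aco * a + α * aco * e
          - α * (aco * (1 - a * aco)) * e * α * (1 - aco * a) := by
          rw [hf, hε, hf₀]; noncomm_ring
      _ = 1 - α * (1 - aco * a) := by rw [hxp, hα₂]; noncomm_ring
  refine ⟨?_, ?_, ?_⟩
  · have hγf : γ * f = α * (1 - aco * a) * f := by
      calc γ * f = α * (1 - aco * a) * ((1 + e * aco) * β) * f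
            - α * (1 - aco * a) * (1 + e * aco) * ((1 - a * aco) * β * f) := by
            rw [hγ]; noncomm_ring
        _ = α * (1 - aco * a) * f := by rw [hvβ, hleft, mul_one, mul_zero, sub_zero]
    rw [← mul_assoc, hf₀f, sub_mul, sub_mul, hγf]
  · have hfσ : f * σ = f * ((1 - a * aco) * β) := by
      calc f * σ = f * (α * (1 + aco * e)) * ((1 - a * aco) * β)
            - f * (α * (1 - aco * a)) * (1 + aco * e) * ((1 - a * aco) * β) := by
            rw [hσ]; noncomm_ring
        _ = f * ((1 - a * aco) * β) := by
            rw [hl, hright, mul_one, zero_mul, zero_mul, sub_zero]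
    rw [mul_assoc, hff₀, mul_sub, mul_sub, hfσ]
  · have hδ' : δ = (1 - star β) * (1 - a * aco) * β := by
      rw [hδ, ← star_one R, ← star_sub, ← hexβ, star_mul, star_mul, star_one, ← mul_assoc]
    have hstar : star f * star β * (1 - a * aco) = 0 := by
      have h := congrArg star hleft
      rwa [star_mul, star_mul, star_sub, star_one, hsa, star_zero, ← mul_assoc] at h
    have hfδ : star f * δ = star f * ((1 - a * aco) * β) := by
      calc star f * δ = star f * ((1 - a * aco) * β)
            - star f * star β * (1 - a * aco) * β := by rw [hδ']; noncomm_ring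
        _ = star f * ((1 - a * aco) * β) := by rw [hstar, zero_mul, sub_zero]
    rw [mul_assoc, hff₀, mul_sub, mul_sub, hfδ]
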